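/- Let X and Y be real Banach spaces and let H be a closed subspace of L(X,Y) such that the rank-one operator x* ⊗ y belongs to H for every x* ∈ X* and y ∈ Y. Then the dual H* has the w*-Ball Dentable Property if and only if X** has the w*-Ball Dentable Property and Y* has the w*-Ball Dentable Property. -/

import Mathlib

set_option synthInstance.maxHeartbeats 1000000
set_option maxHeartbeats 1000000

open Metric Set Filter

noncomputable section

/-- A Banach space `Z` has the **Ball Dentable Property** (`BDP`) if its closed unit ball
has slices of arbitrarily small diameter. -/
def BallDentableProperty (Z : Type*) [NormedAddCommGroup Z] [NormedSpace ℝ Z] : Prop :=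
  ∀ ε : ℝ, 0 < ε → ∃ (f : StrongDual ℝ Z) (α : ℝ), ‖f‖ = 1 ∧ 0 < α ∧ α < 1 ∧
    Metric.diam {z : Z | ‖z‖ ≤ 1 ∧ 1 - α < f z} < ε

/-- The dual `Z*` of a Banach space `Z` has the **w*-Ball Dentable Property** (`w*-BDP`) if the
closed unit ball of `Z*` has weak-star slices (slices given by elements of the predual `Z`)
of arbitrarily small diameter. -/
def WStarBallDentableProperty (Z : Type*) [NormedAddCommGroup Z] [NormedSpace ℝ Z] : Prop :=
  ∀ ε : ℝ, 0 < ε → ∃ (z : Z) (α : ℝ), ‖z‖ = 1 ∧ 0 < α ∧ α < 1 ∧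
    Metric.diam {f : StrongDual ℝ Z | ‖f‖ ≤ 1 ∧ 1 - α < f z} < ε

/-- A Banach space `Z` has the **Ball Small Combination of Slices Property** (`BSCSP`) if its
closed unit ball has convex combinations of slices of arbitrarily small diameter. -/
def BallSCSProperty (Z : Type*) [NormedAddCommGroup Z] [NormedSpace ℝ Z] : Prop :=
  ∀ ε : ℝ, 0 < ε → ∃ (n : ℕ) (lam : Fin (n + 1) → ℝ) (f : Fin (n + 1) → StrongDual ℝ Z)
    (α : Fin (n + 1) → ℝ),
    (∀ i, 0 < lam i) ∧ (∑ i, lam i = 1) ∧ (∀ i, ‖f i‖ = 1) ∧ (∀ i, 0 < α i ∧ α i < 1) ∧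
    Metric.diam {z : Z | ∃ g : Fin (n + 1) → Z,
      (∀ i, ‖g i‖ ≤ 1 ∧ 1 - α i < f i (g i)) ∧ z = ∑ i, lam i • g i} < ε

/-- The dual `Z*` of a Banach space `Z` has the **w*-Ball Small Combination of Slices Property**
(`w*-BSCSP`) if the closed unit ball of `Z*` has convex combinations of weak-star slices
(slices given by elements of the predual `Z`) of arbitrarily small diameter. -/
def WStarBallSCSProperty (Z : Type*) [NormedAddCommGroup Z] [NormedSpace ℝ Z] : Prop :=
  ∀ ε : ℝ, 0 < ε → ∃ (n : ℕ) (lam : Fin (n + 1) → ℝ) (z : Fin (n + 1) → Z)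
    (α : Fin (n + 1) → ℝ),
    (∀ i, 0 < lam i) ∧ (∑ i, lam i = 1) ∧ (∀ i, ‖z i‖ = 1) ∧ (∀ i, 0 < α i ∧ α i < 1) ∧
    Metric.diam {φ : StrongDual ℝ Z | ∃ g : Fin (n + 1) → StrongDual ℝ Z,
      (∀ i, ‖g i‖ ≤ 1 ∧ 1 - α i < g i (z i)) ∧ φ = ∑ i, lam i • g i} < ε

/-- The roughness `η(Z, u)` of the norm of `Z` at `u`:
`limsup_{‖h‖ → 0} (‖u + h‖ + ‖u - h‖ - 2) / ‖h‖`. -/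
noncomputable def roughness (Z : Type*) [NormedAddCommGroup Z] (u : Z) : ℝ :=
  Filter.limsup (fun h : Z => (‖u + h‖ + ‖u - h‖ - 2) / ‖h‖) (nhdsWithin 0 {(0 : Z)}ᶜ)

/-- The norm of `Z` is **rough** if it is `ε`-rough for some `ε > 0`, i.e. there is `ε > 0`
with `η(Z, u) ≥ ε` for every `u` in the unit sphere of `Z`. -/
def RoughNorm (Z : Type*) [NormedAddCommGroup Z] : Prop :=
  ∃ ε : ℝ, 0 < ε ∧ ∀ u : Z, ‖u‖ = 1 → ε ≤ roughness Z u

/-- The norm of `Z` is **non-rough** if it is not rough. -/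
def NonRoughNorm (Z : Type*) [NormedAddCommGroup Z] : Prop := ¬ RoughNorm Z

/-- The rank-one operator `x* ⊗ y : E → F`, `x ↦ x*(x) • y`. -/
noncomputable def rankOneOp {E F : Type*} [NormedAddCommGroup E] [NormedSpace ℝ E]
    [NormedAddCommGroup F] [NormedSpace ℝ F] (f : StrongDual ℝ E) (y : F) : E →L[ℝ] F :=
  f.smulRight y

/-- For a subspace `H ⊆ L(E, F)`, a vector `x ∈ E` and a functional `g ∈ F*`, the functional
`x ⊗ g ∈ H*` given by `T ↦ g (T x)`. -/
noncomputable def dualTensorFunctional {E F : Type*} [NormedAddCommGroup E] [NormedSpace ℝ E]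
    [NormedAddCommGroup F] [NormedSpace ℝ F] (H : Submodule ℝ (E →L[ℝ] F)) (x : E)
    (g : StrongDual ℝ F) : StrongDual ℝ H :=
  g.comp ((ContinuousLinearMap.apply ℝ F x).comp H.subtypeL)

/-- The weak-star closed convex hull of a subset `S` of the dual `Z*`. -/
noncomputable def wStarClosedConvexHull (Z : Type*) [NormedAddCommGroup Z] [NormedSpace ℝ Z]
    (S : Set (StrongDual ℝ Z)) : Set (StrongDual ℝ Z) :=
  StrongDual.toWeakDual ⁻¹'
    closure (convexHull ℝ (StrongDual.toWeakDual '' S))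

/-- `D(Z, u)`: the set of norm-at-most-one functionals attaining the value `1` at `u`. -/
def dualFace (Z : Type*) [NormedAddCommGroup Z] [NormedSpace ℝ Z] (u : Z) :
    Set (StrongDual ℝ Z) := {h | ‖h‖ ≤ 1 ∧ h u = 1}

/-- `n(Z, u)`: the largest non-negative `k` such that
`k * ‖z‖ ≤ sup {|f z| : f ∈ D(Z, u)}` for every `z ∈ Z`. -/
noncomputable def nConstant (Z : Type*) [NormedAddCommGroup Z] [NormedSpace ℝ Z] (u : Z) : ℝ :=
  sSup {k : ℝ | 0 ≤ k ∧ ∀ z : Z, k * ‖z‖ ≤ ⨆ f : dualFace Z u, |f.1 z|}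

/-- The Banach space `B(X × Y)` of bounded bilinear forms on `X × Y`, realized as
`X →L[ℝ] Y →L[ℝ] ℝ`. -/
def BoundedBilinearForms (X Y : Type*) [NormedAddCommGroup X] [NormedSpace ℝ X]
    [NormedAddCommGroup Y] [NormedSpace ℝ Y] : Type _ :=
  X →L[ℝ] Y →L[ℝ] ℝ

noncomputable instance {X Y : Type*} [NormedAddCommGroup X] [NormedSpace ℝ X]
    [NormedAddCommGroup Y] [NormedSpace ℝ Y] : NormedAddCommGroup (BoundedBilinearForms X Y) :=
  inferInstanceAs (NormedAddCommGroup (X →L[ℝ] Y →L[ℝ] ℝ))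

noncomputable instance {X Y : Type*} [NormedAddCommGroup X] [NormedSpace ℝ X]
    [NormedAddCommGroup Y] [NormedSpace ℝ Y] : NormedSpace ℝ (BoundedBilinearForms X Y) :=
  inferInstanceAs (NormedSpace ℝ (X →L[ℝ] Y →L[ℝ] ℝ))

/-- The canonical image of the elementary tensor `x ⊗ y` in the dual of the space of bounded
bilinear forms on `X × Y`; it acts by `B ↦ B x y`. -/
noncomputable def projTensorElem {X Y : Type*} [NormedAddCommGroup X] [NormedSpace ℝ X]
    [NormedAddCommGroup Y] [NormedSpace ℝ Y] (x : X) (y : Y) :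
    StrongDual ℝ (BoundedBilinearForms X Y) :=
  (ContinuousLinearMap.apply ℝ ℝ y).comp (ContinuousLinearMap.apply ℝ (Y →L[ℝ] ℝ) x)

/-- The projective tensor product `X ⊗̂_π Y`, realized canonically (and isometrically) as the
closure of the span of the elementary tensors inside the dual of the Banach space of bounded
bilinear forms on `X × Y`.  (On elementary tensor combinations the dual norm coincides with the
projective norm, so this closed subspace is the canonical isometric copy of the completion
`X ⊗̂_π Y`.) -/
noncomputable def ProjectiveTensorProduct (X Y : Type*) [NormedAddCommGroup X] [NormedSpace ℝ X]
    [NormedAddCommGroup Y] [NormedSpace ℝ Y] :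
    Submodule ℝ (StrongDual ℝ (BoundedBilinearForms X Y)) :=
  (Submodule.span ℝ {φ | ∃ x y, φ = projTensorElem x y}).topologicalClosure

/-- The projective tensor product `X ⊗̂_π Y` as a Banach space. -/
def ProjectiveTensorSpace (X Y : Type*) [NormedAddCommGroup X] [NormedSpace ℝ X]
    [NormedAddCommGroup Y] [NormedSpace ℝ Y] : Type _ :=
  ↥(ProjectiveTensorProduct X Y)

noncomputable instance {X Y : Type*} [NormedAddCommGroup X] [NormedSpace ℝ X]
    [NormedAddCommGroup Y] [NormedSpace ℝ Y] : NormedAddCommGroup (ProjectiveTensorSpace X Y) :=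
  inferInstanceAs (NormedAddCommGroup ↥(ProjectiveTensorProduct X Y))

noncomputable instance {X Y : Type*} [NormedAddCommGroup X] [NormedSpace ℝ X]
    [NormedAddCommGroup Y] [NormedSpace ℝ Y] : NormedSpace ℝ (ProjectiveTensorSpace X Y) :=
  inferInstanceAs (NormedSpace ℝ ↥(ProjectiveTensorProduct X Y))

/-- The rank-one operator `x ⊗ y : X* → Y`, `x* ↦ x*(x) • y`. -/
noncomputable def injTensorElem {X Y : Type*} [NormedAddCommGroup X] [NormedSpace ℝ X]
    [NormedAddCommGroup Y] [NormedSpace ℝ Y] (x : X) (y : Y) :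
    StrongDual ℝ X →L[ℝ] Y :=
  (ContinuousLinearMap.apply ℝ ℝ x).smulRight y

/-- The injective tensor product `X ⊗̂_ε Y`, realized canonically (and isometrically) as the
closure of the span of the rank-one operators `x ⊗ y` inside the Banach space `L(X*, Y)`.
(On elementary tensor combinations the operator norm coincides with the injective norm, so this
closed subspace is the canonical isometric copy of the completion `X ⊗̂_ε Y`.) -/
noncomputable def InjectiveTensorProduct (X Y : Type*) [NormedAddCommGroup X] [NormedSpace ℝ X]
    [NormedAddCommGroup Y] [NormedSpace ℝ Y] :
    Submodule ℝ (StrongDual ℝ X →L[ℝ] Y) :=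
  haveI : ContinuousAdd (StrongDual ℝ X →L[ℝ] Y) :=
    ContinuousLinearMap.topologicalAddGroup.toContinuousAdd
  (Submodule.span ℝ {T | ∃ x y, T = injTensorElem x y}).topologicalClosure

/-- The injective tensor product `X ⊗̂_ε Y` as a Banach space. -/
def InjectiveTensorSpace (X Y : Type*) [NormedAddCommGroup X] [NormedSpace ℝ X]
    [NormedAddCommGroup Y] [NormedSpace ℝ Y] : Type _ :=
  ↥(InjectiveTensorProduct X Y)

noncomputable instance {X Y : Type*} [NormedAddCommGroup X] [NormedSpace ℝ X]
    [NormedAddCommGroup Y] [NormedSpace ℝ Y] : NormedAddCommGroup (InjectiveTensorSpace X Y) :=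
  @Submodule.normedAddCommGroup ℝ (StrongDual ℝ X →L[ℝ] Y) _
    ContinuousLinearMap.toNormedAddCommGroup ContinuousLinearMap.module
    (InjectiveTensorProduct X Y)

noncomputable instance {X Y : Type*} [NormedAddCommGroup X] [NormedSpace ℝ X]
    [NormedAddCommGroup Y] [NormedSpace ℝ Y] : NormedSpace ℝ (InjectiveTensorSpace X Y) :=
  @Submodule.normedSpace ℝ ℝ _ _ _ (StrongDual ℝ X →L[ℝ] Y)
    ContinuousLinearMap.toNormedAddCommGroup.toSeminormedAddCommGroup
    ContinuousLinearMap.toNormedSpace ContinuousLinearMap.module _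
    (InjectiveTensorProduct X Y)

end


lemma wbdp_iff_aux (Z : Type*) [NormedAddCommGroup Z] [NormedSpace ℝ Z] :
    WStarBallDentableProperty Z ↔ ∀ ε : ℝ, 0 < ε → ∃ (z : Z) (α : ℝ), ‖z‖ = 1 ∧ 0 < α ∧ α < 1 ∧
      ∀ f g : StrongDual ℝ Z, ‖f‖ ≤ 1 → ‖g‖ ≤ 1 → 1 - α < f z → 1 - α < g z → ‖f - g‖ ≤ ε := by
  constructor
  · intro h ε hε
    obtain ⟨z, α, hz, h0, h1, hd⟩ := h ε hε
    refine ⟨z, α, hz, h0, h1, fun f g hf hg hfz hgz => ?_⟩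
    rw [← dist_eq_norm]
    refine (Metric.dist_le_diam_of_mem
      (s := {f : StrongDual ℝ Z | ‖f‖ ≤ 1 ∧ 1 - α < f z}) ?_ ⟨hf, hfz⟩ ⟨hg, hgz⟩).trans hd.le
    refine (Metric.isBounded_closedBall (x := (0 : StrongDual ℝ Z)) (r := 1)).subset ?_
    intro f hf
    simpa using hf.1
  · intro h ε hε
    obtain ⟨z, α, hz, h0, h1, hd⟩ := h (ε / 2) (by linarith)
    refine ⟨z, α, hz, h0, h1, lt_of_le_of_lt (Metric.diam_le_of_forall_dist_le (C := ε / 2)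
      (by linarith) ?_) (by linarith)⟩
    intro f hf g hg
    rw [dist_eq_norm]
    exact hd f g hf.1 hg.1 hf.2 hg.2

lemma transfer_aux {W Z : Type*} [NormedAddCommGroup W] [NormedSpace ℝ W]
    [NormedAddCommGroup Z] [NormedSpace ℝ Z] (ε α : ℝ) (hε : 0 < ε) (h1 : α < 1) (T : W)
    (hT : ‖T‖ = 1)
    (hd : ∀ f g : StrongDual ℝ W, ‖f‖ ≤ 1 → ‖g‖ ≤ 1 → 1 - α < f T → 1 - α < g T → ‖f - g‖ ≤ ε)
    (A : W →L[ℝ] Z) (hA : ∀ w, ‖A w‖ ≤ ‖w‖) (J : Z → W) (hJ : ∀ z, ‖J z‖ ≤ ‖z‖)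
    (hAJ : ∀ z, A (J z) = z) (hAT : 1 - α < ‖A T‖) :
    ∃ (z : Z) (α : ℝ), ‖z‖ = 1 ∧ 0 < α ∧ α < 1 ∧
      ∀ f g : StrongDual ℝ Z, ‖f‖ ≤ 1 → ‖g‖ ≤ 1 → 1 - α < f z → 1 - α < g z → ‖f - g‖ ≤ ε := by
  have hc : 0 < ‖A T‖ := by linarith
  have key : ∀ f : StrongDual ℝ Z, ‖f‖ ≤ 1 → (1 - α) / ‖A T‖ < f (‖A T‖⁻¹ • A T) →
      ‖f.comp A‖ ≤ 1 ∧ 1 - α < f.comp A T := by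
    intro f hf hfz
    constructor
    · refine ContinuousLinearMap.opNorm_le_bound _ zero_le_one fun w => ?_
      calc ‖f (A w)‖ ≤ ‖f‖ * ‖A w‖ := f.le_opNorm _
        _ ≤ 1 * ‖w‖ := mul_le_mul hf (hA w) (norm_nonneg _) zero_le_one
    · rw [map_smul, smul_eq_mul, ← div_eq_inv_mul, div_lt_div_iff_of_pos_right hc] at hfz
      exact hfz
  refine ⟨‖A T‖⁻¹ • A T, 1 - (1 - α) / ‖A T‖, ?_, ?_, ?_, ?_⟩
  · rw [norm_smul, norm_inv, norm_norm, inv_mul_cancel₀ hc.ne']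
  · have : (1 - α) / ‖A T‖ < 1 := (div_lt_one hc).2 hAT
    linarith
  · have : 0 < (1 - α) / ‖A T‖ := div_pos (by linarith) hc
    linarith
  · intro f g hf hg hfz hgz
    rw [sub_sub_cancel] at hfz hgz
    obtain ⟨a1, a2⟩ := key f hf hfz
    obtain ⟨b1, b2⟩ := key g hg hgz
    have h := hd _ _ a1 b1 a2 b2
    refine ContinuousLinearMap.opNorm_le_bound _ hε.le fun z => ?_
    have h2 := (f.comp A - g.comp A).le_opNorm (J z)
    simp only [sub_apply, ContinuousLinearMap.comp_apply, hAJ] at h2 ⊢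
    exact h2.trans (mul_le_mul h (hJ z) (norm_nonneg _) hε.le)

lemma exists_norming_aux {E F : Type*} [NormedAddCommGroup E] [NormedSpace ℝ E]
    [NormedAddCommGroup F] [NormedSpace ℝ F] (T : E →L[ℝ] F) (hT : ‖T‖ = 1) (a : ℝ) (ha : a < 1) :
    ∃ x : E, ‖x‖ = 1 ∧ a < ‖T x‖ := by
  obtain ⟨x, hx, hx2⟩ := T.exists_lt_apply_of_lt_opNorm (r := max a 0) (by simp [hT, ha])
  have hx0 : 0 < ‖T x‖ := lt_of_le_of_lt (le_max_right _ _) hx2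
  have hxp : 0 < ‖x‖ := by
    rw [norm_pos_iff]; rintro rfl; simp at hx0
  refine ⟨‖x‖⁻¹ • x, by rw [norm_smul, norm_inv, norm_norm, inv_mul_cancel₀ hxp.ne'], ?_⟩
  rw [map_smul, norm_smul, norm_inv, norm_norm]
  have : 1 ≤ ‖x‖⁻¹ := (one_le_inv₀ hxp).2 hx.le
  calc a ≤ max a 0 := le_max_left _ _
    _ < ‖T x‖ := hx2
    _ ≤ _ := le_mul_of_one_le_left hx0.le this

lemma forward_aux {X Y : Type*} [NormedAddCommGroup X] [NormedSpace ℝ X]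
    [NormedAddCommGroup Y] [NormedSpace ℝ Y] (H : Submodule ℝ (X →L[ℝ] Y))
    (hmem : ∀ (f : StrongDual ℝ X) (y : Y), rankOneOp f y ∈ H)
    (h : WStarBallDentableProperty H) :
      WStarBallDentableProperty (StrongDual ℝ X) ∧ WStarBallDentableProperty Y := by
  rw [wbdp_iff_aux] at *
  rw [wbdp_iff_aux]
  constructor
  · intro ε hε
    obtain ⟨T, α, hT, h0, h1, hd⟩ := h ε hε
    obtain ⟨x, hx, hTx⟩ := exists_norming_aux (T : X →L[ℝ] Y) hT (1 - α) (by linarith)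
    have hp : 0 < ‖(T : X →L[ℝ] Y) x‖ := by linarith
    obtain ⟨q, hq, hqT⟩ := exists_dual_vector ℝ ((T : X →L[ℝ] Y) x) hp.ne'
    simp only [RCLike.ofReal_real_eq_id, id] at hqT
    refine transfer_aux ε α hε h1 T hT hd
      ((ContinuousLinearMap.compL ℝ X Y ℝ q).comp H.subtypeL) ?_
      (fun f => ⟨rankOneOp f (‖(T : X →L[ℝ] Y) x‖⁻¹ • (T : X →L[ℝ] Y) x), hmem _ _⟩) ?_ ?_ ?_
    · intro S
      have := ContinuousLinearMap.opNorm_comp_le q (S : X →L[ℝ] Y)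
      rw [hq, one_mul] at this
      exact this
    · intro f
      change ‖f.smulRight (‖(T : X →L[ℝ] Y) x‖⁻¹ • (T : X →L[ℝ] Y) x)‖ ≤ ‖f‖
      rw [ContinuousLinearMap.norm_smulRight_apply, norm_smul, norm_inv, norm_norm,
        inv_mul_cancel₀ hp.ne', mul_one]
    · intro f
      ext z
      change q (f z • (‖(T : X →L[ℝ] Y) x‖⁻¹ • (T : X →L[ℝ] Y) x)) = f z
      rw [map_smul, map_smul, hqT]
      simp [inv_mul_cancel₀ hp.ne']
    · change 1 - α < ‖q.comp (T : X →L[ℝ] Y)‖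
      have := (q.comp (T : X →L[ℝ] Y)).le_opNorm x
      rw [hx, mul_one, ContinuousLinearMap.comp_apply, hqT, norm_norm] at this
      linarith
  · intro ε hε
    obtain ⟨T, α, hT, h0, h1, hd⟩ := h ε hε
    obtain ⟨x, hx, hTx⟩ := exists_norming_aux (T : X →L[ℝ] Y) hT (1 - α) (by linarith)
    obtain ⟨p, hp, hpx⟩ := exists_dual_vector ℝ x (by rw [hx]; exact one_ne_zero)
    simp only [RCLike.ofReal_real_eq_id, id] at hpx
    refine transfer_aux ε α hε h1 T hT hd
      ((ContinuousLinearMap.apply ℝ Y x).comp H.subtypeL) ?_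
      (fun y => ⟨rankOneOp p y, hmem _ _⟩) ?_ ?_ hTx
    · intro S
      have := (S : X →L[ℝ] Y).le_opNorm x
      rw [hx, mul_one] at this
      exact this
    · intro y
      change ‖p.smulRight y‖ ≤ _
      rw [ContinuousLinearMap.norm_smulRight_apply, hp, one_mul]
    · intro y
      change p x • y = y
      rw [hpx, hx, one_smul]

lemma norm_est_aux {X Y : Type*} [NormedAddCommGroup X] [NormedSpace ℝ X]
    [NormedAddCommGroup Y] [NormedSpace ℝ Y] (p : StrongDual ℝ X) (y : Y) (hp : ‖p‖ = 1)
    (hy : ‖y‖ = 1) (δ ε : ℝ) (hδ : 0 < δ) (hδ1 : δ < 1) (hε : 0 < ε)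
    (h1 : ∀ u v : X, ‖u‖ ≤ 1 → ‖v‖ ≤ 1 → 1 - δ < p u → 1 - δ < p v → ‖u - v‖ ≤ ε)
    (h2 : ∀ f g : StrongDual ℝ Y, ‖f‖ ≤ 1 → ‖g‖ ≤ 1 → 1 - δ < f y → 1 - δ < g y → ‖f - g‖ ≤ ε)
    (u : X) (hu : ‖u‖ ≤ 1) (hpu : 1 - δ < p u)
    (q : StrongDual ℝ Y) (hq : ‖q‖ ≤ 1) (hqy : 1 - δ < q y)
    (S : X →L[ℝ] Y) (hS : ‖S‖ ≤ 1) :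
    ‖rankOneOp p y + (δ / 2) • S‖ ≤ 1 + (δ / 2) * (q (S u) + 2 * ε) := by
  have bd : ∀ (f : StrongDual ℝ Y) (v : X) (a b : ℝ), ‖f‖ ≤ a → ‖v‖ ≤ b → 0 ≤ a → 0 ≤ b →
      |f (S v)| ≤ a * b := by
    intro f v a b hf hv ha hb
    calc |f (S v)| ≤ ‖f‖ * ‖S v‖ := f.le_opNorm _
      _ ≤ a * b := mul_le_mul hf ?_ (norm_nonneg _) ha
    calc ‖S v‖ ≤ ‖S‖ * ‖v‖ := S.le_opNorm _
      _ ≤ 1 * b := mul_le_mul hS hv (norm_nonneg _) zero_le_one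
      _ = b := one_mul _
  have hqu := abs_le.1 (bd q u 1 1 hq hu zero_le_one zero_le_one)
  have main : ∀ (v : X) (f : StrongDual ℝ Y), ‖v‖ = 1 → ‖f‖ = 1 →
      0 ≤ p v → p v * f y + (δ / 2) * f (S v) ≤ 1 + (δ / 2) * (q (S u) + 2 * ε) := by
    intro v f hv hf hpv
    have hpv1 : p v ≤ 1 := by
      have := (le_abs_self _).trans (p.le_opNorm v)
      rwa [hp, hv, one_mul] at this
    have hfy1 : f y ≤ 1 := by
      have := (le_abs_self _).trans (f.le_opNorm y)
      rwa [hf, hy, one_mul] at this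
    have hle1 : p v * f y ≤ 1 := by nlinarith
    by_cases hc : 1 - δ < p v * f y
    · have hfp : 0 < f y := by
        by_contra hcon
        push Not at hcon
        nlinarith
      have a1 : 1 - δ < p v := by nlinarith
      have a2 : 1 - δ < f y := by nlinarith
      have b1 := abs_le.1 (bd f (v - u) 1 ε hf.le (h1 v u hv.le hu a1 hpu) zero_le_one hε.le)
      have b2 := abs_le.1 (bd (f - q) u ε 1 (h2 f q hf.le hq a2 hqy) hu hε.le zero_le_one)
      simp only [map_sub, sub_apply] at b1 b2
      nlinarith [b1.2, b2.2]
    · push Not at hc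
      have b1 := abs_le.1 (bd f v 1 1 hf.le hv.le zero_le_one zero_le_one)
      nlinarith [b1.2, hqu.1, mul_pos hδ hε]
  have hR : 0 ≤ 1 + (δ / 2) * (q (S u) + 2 * ε) := by
    nlinarith [hqu.1, mul_pos hδ hε]
  by_contra hcon
  push Not at hcon
  set R := rankOneOp p y + (δ / 2) • S with hRdef
  obtain ⟨v, hv, hlt⟩ : ∃ v : X, ‖v‖ = 1 ∧ 1 + (δ / 2) * (q (S u) + 2 * ε) < ‖R v‖ := by
    by_contra hno
    push Not at hno
    refine absurd (ContinuousLinearMap.opNorm_le_bound R hR fun v => ?_) (not_le.2 hcon)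
    by_cases hv : v = 0
    · simp [hv]
    have hvp : 0 < ‖v‖ := norm_pos_iff.2 hv
    have := hno (‖v‖⁻¹ • v) (by rw [norm_smul, norm_inv, norm_norm, inv_mul_cancel₀ hvp.ne'])
    rwa [map_smul, norm_smul, norm_inv, norm_norm, ← div_eq_inv_mul, div_le_iff₀ hvp] at this
  have hRv : R v ≠ 0 := by
    intro h0
    rw [h0, norm_zero] at hlt
    linarith
  obtain ⟨f, hf, hfv⟩ := exists_dual_vector ℝ (R v) (norm_ne_zero_iff.2 hRv)
  simp only [RCLike.ofReal_real_eq_id, id] at hfv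
  have hev : R v = p v • y + (δ / 2) • S v := rfl
  rw [← hfv, hev, map_add, map_smul, map_smul, smul_eq_mul, smul_eq_mul] at hlt
  rcases le_total 0 (p v) with hpv | hpv
  · linarith [main v f hv hf hpv]
  · have := main (-v) (-f) (by rwa [norm_neg]) (by rwa [norm_neg]) (by rw [map_neg]; linarith)
    simp only [map_neg, neg_apply, neg_neg, neg_mul_neg] at this
    linarith

lemma slice_aux {W : Type*} [NormedAddCommGroup W] [NormedSpace ℝ W] (T : W) (hT : ‖T‖ = 1)
    (L : W → ℝ) (hL : ∀ S, L (-S) = - L S) (δ ε : ℝ) (hδ : 0 < δ) (hε : 0 < ε)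
    (est : ∀ S : W, ‖S‖ ≤ 1 → ‖T + (δ / 2) • S‖ ≤ 1 + (δ / 2) * (L S + 2 * ε)) :
    ∃ (z : W) (α : ℝ), ‖z‖ = 1 ∧ 0 < α ∧ α < 1 ∧
      ∀ f g : StrongDual ℝ W, ‖f‖ ≤ 1 → ‖g‖ ≤ 1 → 1 - α < f z → 1 - α < g z →
        ‖f - g‖ ≤ 6 * ε := by
  have hmin : 0 < min (δ / 2 * ε) (1 / 2) := lt_min (by positivity) (by norm_num)
  have one : ∀ φ : StrongDual ℝ W, ‖φ‖ ≤ 1 → 1 - δ / 2 * ε < φ T → ∀ S : W, ‖S‖ ≤ 1 →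
      φ S ≤ L S + 3 * ε := by
    intro φ hφ hφT S hS
    have e3 := est S hS
    have e2 : φ (T + (δ / 2) • S) ≤ ‖T + (δ / 2) • S‖ := by
      refine (le_abs_self _).trans ((φ.le_opNorm _).trans ?_)
      exact mul_le_of_le_one_left (norm_nonneg _) hφ
    rw [map_add, map_smul, smul_eq_mul] at e2
    have : δ / 2 * φ S ≤ δ / 2 * (L S + 3 * ε) := by linarith
    exact le_of_mul_le_mul_left this (by linarith)
  refine ⟨T, min (δ / 2 * ε) (1 / 2), hT, hmin, (min_le_right _ _).trans_lt (by norm_num), ?_⟩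
  intro f g hf hg hfT hgT
  have hf' : 1 - δ / 2 * ε < f T := by linarith [min_le_left (δ / 2 * ε) (1 / 2)]
  have hg' : 1 - δ / 2 * ε < g T := by linarith [min_le_left (δ / 2 * ε) (1 / 2)]
  refine ContinuousLinearMap.opNorm_le_of_unit_norm (by linarith) fun S hS => ?_
  have a := one f hf hf' S hS.le
  have b := one g hg hg' S hS.le
  have c := one f hf hf' (-S) (by rw [norm_neg]; exact hS.le)
  have d := one g hg hg' (-S) (by rw [norm_neg]; exact hS.le)
  rw [map_neg, hL] at c d
  rw [Real.norm_eq_abs, sub_apply, abs_le]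
  constructor <;> linarith

lemma backward_aux {X Y : Type*} [NormedAddCommGroup X] [NormedSpace ℝ X]
    [NormedAddCommGroup Y] [NormedSpace ℝ Y] (H : Submodule ℝ (X →L[ℝ] Y))
    (hmem : ∀ (f : StrongDual ℝ X) (y : Y), rankOneOp f y ∈ H)
    (hX : WStarBallDentableProperty (StrongDual ℝ X)) (hY : WStarBallDentableProperty Y) :
    WStarBallDentableProperty H := by
  rw [wbdp_iff_aux] at *
  intro ε' hε'
  obtain ⟨ε, hε, rfl⟩ : ∃ ε : ℝ, 0 < ε ∧ ε' = 6 * ε := ⟨ε' / 6, by linarith, by ring⟩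
  obtain ⟨p, α, hp, hα, hα1, hpd⟩ := hX ε hε
  obtain ⟨y, β, hy, hβ, hβ1, hyd⟩ := hY ε hε
  obtain ⟨δ, hδ, hδ1, hδα, hδβ⟩ : ∃ δ : ℝ, 0 < δ ∧ δ < 1 ∧ δ ≤ α ∧ δ ≤ β :=
    ⟨min α β, lt_min hα hβ, (min_le_left _ _).trans_lt hα1, min_le_left _ _, min_le_right _ _⟩
  have h1 : ∀ u v : X, ‖u‖ ≤ 1 → ‖v‖ ≤ 1 → 1 - δ < p u → 1 - δ < p v → ‖u - v‖ ≤ ε := by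
    intro u v hu hv hpu hpv
    have := hpd (NormedSpace.inclusionInDoubleDualLi ℝ u) (NormedSpace.inclusionInDoubleDualLi ℝ v)
      (by rwa [LinearIsometry.norm_map]) (by rwa [LinearIsometry.norm_map])
      (by change 1 - α < p u; linarith) (by change 1 - α < p v; linarith)
    rwa [← LinearIsometry.map_sub, LinearIsometry.norm_map] at this
  have h2 : ∀ f g : StrongDual ℝ Y, ‖f‖ ≤ 1 → ‖g‖ ≤ 1 → 1 - δ < f y → 1 - δ < g y →
      ‖f - g‖ ≤ ε := fun f g hf hg hfy hgy =>
    hyd f g hf hg (by linarith) (by linarith)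
  obtain ⟨u, hu, hpu⟩ : ∃ u : X, ‖u‖ = 1 ∧ 1 - δ < p u := by
    obtain ⟨u, hu, hpu⟩ := exists_norming_aux p hp (1 - δ) (by linarith)
    rw [Real.norm_eq_abs] at hpu
    rcases lt_abs.1 hpu with h | h
    · exact ⟨u, hu, h⟩
    · exact ⟨-u, by rwa [norm_neg], by rwa [map_neg]⟩
  obtain ⟨q, hq, hqy⟩ := exists_dual_vector ℝ y (by rw [hy]; exact one_ne_zero)
  simp only [RCLike.ofReal_real_eq_id, id, hy] at hqy
  have est := norm_est_aux p y hp hy δ ε hδ hδ1 hε h1 h2 u hu.le hpu q hq.le (by linarith)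
  refine slice_aux (⟨rankOneOp p y, hmem p y⟩ : H) ?_ (fun S => q ((S : X →L[ℝ] Y) u)) ?_
    δ ε hδ hε (fun S hS => est (S : X →L[ℝ] Y) hS)
  · change ‖p.smulRight y‖ = 1
    rw [ContinuousLinearMap.norm_smulRight_apply, hp, hy, one_mul]
  · intro S
    change q (-((S : X →L[ℝ] Y) u)) = _
    rw [map_neg]

/-- Theorem 2.6: if `H` is a closed subspace of `L(X, Y)` with `X* ⊗ Y ⊆ H`,
then `H*` has the `w*`-BDP if and only if `X**` and `Y*` have the `w*`-BDP. -/
theorem statement3 {X Y : Type*} [NormedAddCommGroup X] [NormedSpace ℝ X] [CompleteSpace X]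
    [NormedAddCommGroup Y] [NormedSpace ℝ Y] [CompleteSpace Y]
    (H : Submodule ℝ (X →L[ℝ] Y)) (hH : IsClosed (H : Set (X →L[ℝ] Y)))
    (hmem : ∀ (f : StrongDual ℝ X) (y : Y), rankOneOp f y ∈ H) :
    WStarBallDentableProperty H ↔
      WStarBallDentableProperty (StrongDual ℝ X) ∧ WStarBallDentableProperty Y := by
  exact ⟨forward_aux H hmem, fun h => backward_aux H hmem h.1 h.2⟩
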